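/- arXiv:1812.06419 — 2 statements merged into one kernel-verified Lean document; each statement's English description precedes it below -/
import Mathlib

section
/- Let n ≥ 5 with n ≠ 6, and let N be a group with a normal subgroup A of index 2 such that A is isomorphic to the alternating group Aₙ. Then the extension 1 → A → N → C₂ → 1 splits; equivalently, there exists an element of order 2 in N that does not lie in A. -/
open Equiv Equiv.Perm

def Cyc {α : Type*} (g : Perm α) (a b c : α) : Prop :=
  a ≠ b ∧ b ≠ c ∧ a ≠ c ∧ g a = b ∧ g b = c ∧ g c = a ∧ ∀ x, x = a ∨ x = b ∨ x = c ∨ g x = x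

theorem Cyc.unique {α : Type*} {g h : Perm α} {a b c : α} (hg : Cyc g a b c) (hh : Cyc h a b c) : g = h := by
  ext x
  unfold Cyc at *
  grind

theorem cyc_mul {α : Type*} {g h : Perm α} {p q i j : α} (hg : Cyc g p q j) (hh : Cyc h p q i) (hij : i ≠ j) :
    Cyc (g * h⁻¹) p i j := by
  obtain ⟨h1,h2,h3,h4,h5,h6,h7⟩ := hg
  obtain ⟨k1,k2,k3,k4,k5,k6,k7⟩ := hh
  have e1 : h⁻¹ p = i := by rw [inv_eq_iff_eq, k6]
  have e2 : h⁻¹ i = q := by rw [inv_eq_iff_eq, k5]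
  have e3 : h⁻¹ q = p := by rw [inv_eq_iff_eq, k4]
  have e4 : ∀ x, x = p ∨ x = q ∨ x = i ∨ h⁻¹ x = x := by
    intro x; rw [inv_eq_iff_eq, eq_comm (b := h x)]; exact k7 x
  refine ⟨k3, hij, h3, ?_, ?_, ?_, ?_⟩ <;> simp only [mul_apply] <;> grind

theorem share {α : Type*} {g h : Perm α} {a b c d e f : α} (hg : Cyc g a b c) (hh : Cyc h d e f)
    (h1 : ∀ x, g (h (g (h x))) = x) (h2 : ∃ x, g (h x) ≠ x) : ∃ x, g x ≠ x ∧ g x = h x := by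
  obtain ⟨x, hx⟩ := h2
  by_contra! hc
  have q1 := h1 a; have q2 := h1 b; have q3 := h1 c; have q4 := h1 d; have q5 := h1 e; have q6 := h1 f
  have r1 := hc a; have r2 := hc b; have r3 := hc c
  obtain ⟨g1,g2,g3,g4,g5,g6,g7⟩ := hg
  obtain ⟨k1,k2,k3,k4,k5,k6,k7⟩ := hh
  have := g7 d; have := g7 e; have := g7 f; have := k7 a; have := k7 b; have := k7 c
  have := g7 x; have := k7 x
  clear h1 hc
  clear g7 k7
  grind (splits := 40)

theorem share3 {α : Type*} {g h k : Perm α} {a b c d p q r : α} (hg : Cyc g a b c) (hh : Cyc h a b d)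
  (hk : Cyc k p q r) (hcd : c ≠ d) (h1 : ∃ x, g x ≠ x ∧ g x = k x) (h2 : ∃ x, h x ≠ x ∧ h x = k x) :
   k a = b := by
  unfold Cyc at *
  grind (splits := 40)

theorem cyc_swap {α : Type*} [DecidableEq α] {a b c : α} (h1 : a ≠ b) (h2 : b ≠ c) (h3 : a ≠ c) :
    Cyc (swap a b * swap b c) a b c := by
  refine ⟨h1, h2, h3, ?_, ?_, ?_, ?_⟩ <;> simp only [mul_apply, swap_apply_def] <;> grind

theorem Cyc.three {α : Type*} [Fintype α] [DecidableEq α] {g : Perm α} {a b c : α} (h : Cyc g a b c) : IsThreeCycle g := by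
  rw [h.unique (cyc_swap h.1 h.2.1 h.2.2.1)]
  rw [swap_comm]
  exact isThreeCycle_swap_mul_swap_same h.1.symm h.2.1 h.2.2.1

theorem exists_cyc {α : Type*} [Fintype α] [DecidableEq α] {g : Perm α} (h : IsThreeCycle g) (a : α) (ha : g a ≠ a) :
    Cyc g a (g a) (g (g a)) := by
  have h3 : g ^ 3 = 1 := by rw [← h.orderOf, pow_orderOf_eq_one]
  have h3' : ∀ x, g (g (g x)) = x := fun x => by
    have := congrArg (fun k : Perm α => k x) h3
    simpa [pow_succ] using this
  have hc := h.card_support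
  have h1 : g a ≠ g (g a) := fun e => ha (g.injective e).symm
  have h2 : a ≠ g (g a) := fun e => by
    have := h3' a
    rw [← e] at this; exact ha this
  refine ⟨ha.symm, h1, h2, rfl, rfl, h3' a, ?_⟩
  have hs : ({a, g a, g (g a)} : Finset α) = g.support := by
    apply Finset.eq_of_subset_of_card_le
    · intro x; simp; rintro (rfl | rfl | rfl)
      · exact ha
      · exact h1.symm
      · rw [h3']; exact h2
    · rw [hc, Finset.card_eq_three.2 ⟨_, _, _, ha.symm, h2, h1, rfl⟩]
  intro x
  by_cases hx : g x = x
  · simp [hx]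
  have : x ∈ g.support := by simpa using hx
  rw [← hs] at this
  simp at this
  tauto

theorem Cyc.rot {α : Type*} {g : Perm α} {a b c : α} (h : Cyc g a b c) : Cyc g b c a := by
  unfold Cyc at *; grind

theorem Cyc.conj {α : Type*} {g : Perm α} {a b c : α} (h : Cyc g a b c) (s : Perm α) : Cyc (s * g * s⁻¹) (s a) (s b) (s c) := by
  obtain ⟨h1,h2,h3,h4,h5,h6,h7⟩ := h
  refine ⟨by simpa, by simpa, by simpa, by simp [h4], by simp [h5], by simp [h6], ?_⟩
  intro x
  obtain ⟨y, rfl⟩ := s.surjective x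
  simpa using h7 y

theorem arith (j m : ℕ) (h : 2 ≤ j ∨ (1 ≤ j ∧ 1 ≤ m)) :
    2 * (m.factorial * 3 ^ (j + 1) * (j + 1).factorial) < 3 * (m + 3 * j).factorial := by
  have hm := Nat.factorial_pos m
  have step : ∀ j, 1 ≤ j → 2 * (m.factorial * 3 ^ (j + 1) * (j + 1).factorial) < 3 * (m + 3 * j).factorial →
      2 * (m.factorial * 3 ^ (j + 2) * (j + 2).factorial) < 3 * (m + 3 * (j + 1)).factorial := by
    intro j hj ih
    have e1 : (m + 3 * (j + 1)).factorial = (m + 3 * j + 3) * ((m + 3 * j + 2) * ((m + 3 * j + 1) * (m + 3 * j).factorial)) := by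
      rw [show m + 3 * (j + 1) = m + 3 * j + 2 + 1 by ring, Nat.factorial_succ, Nat.factorial_succ, Nat.factorial_succ]
    have e2 : (j + 2).factorial = (j + 2) * (j + 1).factorial := Nat.factorial_succ _
    rw [e1, e2]
    have hb : 3 * (j + 2) ≤ (m + 3 * j + 3) * ((m + 3 * j + 2) * (m + 3 * j + 1)) := by
      calc 3 * (j + 2) ≤ (m + 3 * j + 3) * (2 * 1) := by omega
        _ ≤ _ := by gcongr <;> omega
    calc 2 * (m.factorial * 3 ^ (j + 2) * ((j + 2) * (j + 1).factorial))
        = (2 * (m.factorial * 3 ^ (j + 1) * (j + 1).factorial)) * (3 * (j + 2)) := by ring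
      _ < (3 * (m + 3 * j).factorial) * (3 * (j + 2)) := by gcongr
      _ ≤ (3 * (m + 3 * j).factorial) * ((m + 3 * j + 3) * ((m + 3 * j + 2) * (m + 3 * j + 1))) := by gcongr
      _ = _ := by ring
  by_cases h1 : 1 ≤ m
  · have hj : 1 ≤ j := by omega
    clear h
    induction j, hj using Nat.le_induction with
    | base =>
      simp only [Nat.factorial_succ, mul_one, zero_add, Nat.factorial_zero]
      have : 2 * 3 * 4 ≤ (m + 1) * (m + 2) * (m + 3) := by gcongr <;> omega
      have := Nat.mul_le_mul_right m.factorial this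
      ring_nf at this ⊢
      omega
    | succ j hj ih => exact step j hj ih
  · have hj : 2 ≤ j := by omega
    have : m = 0 := by omega
    subst this
    clear h
    induction j, hj using Nat.le_induction with
    | base => decide
    | succ j hj ih => exact step j (by omega) ih

theorem phi_three {n : ℕ} (hn : 5 ≤ n) (hn6 : n ≠ 6) (φ : alternatingGroup (Fin n) ≃* alternatingGroup (Fin n))
    (g : alternatingGroup (Fin n)) (hg : IsThreeCycle (g : Perm (Fin n))) :
    IsThreeCycle (φ g : Perm (Fin n)) := by
  have ho : orderOf (φ g : Perm (Fin n)) = 3 := by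
    rw [Subgroup.orderOf_coe, MulEquiv.orderOf_eq, ← Subgroup.orderOf_coe, hg.orderOf]
  obtain ⟨j, hj⟩ := cycleType_prime_order (σ := (φ g : Perm (Fin n))) (by rw [ho]; norm_num)
  rw [ho] at hj
  rcases Nat.eq_zero_or_pos j with rfl | hjp
  · simpa [IsThreeCycle] using hj
  exfalso
  have hsum : 3 * (j + 1) ≤ n := by
    have h1 := sum_cycleType (φ g : Perm (Fin n))
    have h2 := Finset.card_le_univ (φ g : Perm (Fin n)).support
    rw [hj] at h1
    simp at h1 h2
    omega
  obtain ⟨m, rfl⟩ := Nat.exists_eq_add_of_le hsum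
  have c1 := nat_card_centralizer (g : Perm (Fin (3 * (j + 1) + m)))
  have c2 := nat_card_centralizer (φ g : Perm (Fin (3 * (j + 1) + m)))
  rw [hg.cycleType] at c1
  rw [hj] at c2
  simp at c1
  rw [Multiset.toFinset_replicate, if_neg (by omega), Multiset.sum_replicate, Multiset.prod_replicate,
    Finset.prod_singleton, Multiset.count_replicate_self, Fintype.card_fin, smul_eq_mul] at c2
  rw [show (j + 1) * 3 = 3 * (j + 1) by ring, Nat.add_sub_cancel_left] at c2
  rw [show 3 * (j + 1) + m - 3 = m + 3 * j by omega] at c1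
  have ha := arith j m (by omega)
  -- comparison
  have hle1 : Nat.card (Subgroup.centralizer {g}) ≤ Nat.card (Subgroup.centralizer {(φ g : Perm (Fin (3 * (j + 1) + m)))}) := by
    apply Nat.card_le_card_of_injective (fun x => ⟨(φ x.1 : Perm _), by
      have := x.2
      rw [Subgroup.mem_centralizer_singleton_iff] at this ⊢
      rw [← Subgroup.coe_mul, ← Subgroup.coe_mul, ← map_mul, ← map_mul, this]⟩)
    intro x y hxy
    exact Subtype.ext (φ.injective (Subtype.ext (congrArg (fun w => (w.1 : Perm _)) hxy)))
  have hle2 : Nat.card (Subgroup.centralizer {(g : Perm (Fin (3 * (j + 1) + m)))}) ≤ 2 * Nat.card (Subgroup.centralizer {g}) := by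
    set C := Subgroup.centralizer {(g : Perm (Fin (3 * (j + 1) + m)))}
    have : Nontrivial (Fin (3 * (j + 1) + m)) := Fin.nontrivial_iff_two_le.2 (by omega)
    have h1 := ((alternatingGroup (Fin (3 * (j + 1) + m))).subgroupOf C).card_mul_index
    have h2 : ((alternatingGroup (Fin (3 * (j + 1) + m))).subgroupOf C).index ≤ 2 := by
      have := Subgroup.relIndex_dvd_index_of_normal (alternatingGroup (Fin (3 * (j + 1) + m))) C
      rw [alternatingGroup.index_eq_two] at this
      exact Nat.le_of_dvd (by norm_num) this
    have h3 : Nat.card ((alternatingGroup (Fin (3 * (j + 1) + m))).subgroupOf C) ≤ Nat.card (Subgroup.centralizer {g}) := by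
      apply Nat.card_le_card_of_injective (fun x => ⟨⟨x.1.1, x.2⟩, by
        have := x.1.2
        rw [Subgroup.mem_centralizer_singleton_iff] at this ⊢
        exact Subtype.ext this⟩)
      intro x y hxy
      exact Subtype.ext (Subtype.ext (congrArg (fun w => (w.1.1 : Perm _)) hxy))
    rw [← h1, mul_comm]
    gcongr
  have hq : (m + 3 * j).factorial * 3 ≤ 2 * (m.factorial * 3 ^ (j + 1) * (j + 1).factorial) := by
    rw [← c1, ← c2]; omega
  omega

theorem prod2 {α : Type*} {g h : Perm α} {p q i j : α} (hg : Cyc g p q i) (hh : Cyc h p q j) (hij : i ≠ j) :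
    g * h * (g * h) = 1 ∧ g * h ≠ 1 := by
  obtain ⟨g1,g2,g3,g4,g5,g6,g7⟩ := hg
  obtain ⟨k1,k2,k3,k4,k5,k6,k7⟩ := hh
  constructor
  · ext x
    simp only [mul_apply, one_apply]
    have e1 : g j = j := by grind
    have e2 : h i = i := by grind
    by_cases x1 : x = p
    · subst x1; simp [*]
    by_cases x2 : x = q
    · subst x2; simp [*]
    by_cases x3 : x = i
    · subst x3; simp [*]
    by_cases x4 : x = j
    · subst x4; simp [*]
    have e3 : g x = x := by grind
    have e4 : h x = x := by grind
    simp [e3, e4]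
  · intro e
    have := congrArg (fun k : Perm α => k q) e
    simp only [mul_apply, one_apply] at this
    grind

theorem Cyc.inv {α : Type*} {g : Perm α} {a b c : α} (h : Cyc g a b c) : Cyc g⁻¹ a c b := by
  obtain ⟨h1,h2,h3,h4,h5,h6,h7⟩ := h
  refine ⟨h3, h2.symm, h1, ?_, ?_, ?_, fun x => ?_⟩ <;> rw [inv_eq_iff_eq]
  · exact h6.symm
  · exact h5.symm
  · exact h4.symm
  · grind

theorem exists_alt {n : ℕ} {a b c : Fin n} (h1 : a ≠ b) (h2 : b ≠ c) (h3 : a ≠ c) :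
    ∃ t : alternatingGroup (Fin n), Cyc (t : Perm (Fin n)) a b c :=
  ⟨⟨_, (cyc_swap h1 h2 h3).three.mem_alternatingGroup⟩, cyc_swap h1 h2 h3⟩

theorem gen {n : ℕ} (z o : Fin n) (ho : z ≠ o) (E : Subgroup (alternatingGroup (Fin n)))
    (h : ∀ i, ∀ g : alternatingGroup (Fin n), Cyc (g : Perm (Fin n)) z o i → g ∈ E) : E = ⊤ := by
  rw [eq_top_iff, ← alternatingGroup.closure_isThreeCycles_eq_top, Subgroup.closure_le]
  let M (p q r : Fin n) : Prop := ∀ g : alternatingGroup (Fin n), Cyc (g : Perm (Fin n)) p q r → g ∈ E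
  have hrot : ∀ p q r, M p q r → M q r p := fun p q r hM g hg => hM g hg.rot.rot
  have hinv : ∀ p q r, M p q r → M p r q := fun p q r hM g hg => by
    have := hM g⁻¹ hg.inv
    simpa using this
  have hmul : ∀ p q i j, p ≠ q → q ≠ i → q ≠ j → M p q j → M p q i → M p i j := by
    intro p q i j h1 h2 h3 hj hi g hg
    obtain ⟨a, ha⟩ := exists_alt h1 h3 hg.2.2.1
    obtain ⟨b, hb⟩ := exists_alt h1 h2 hg.1
    have : g = a * b⁻¹ := Subtype.ext (hg.unique (cyc_mul ha hb hg.2.1))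
    rw [this]
    exact mul_mem (hj a ha) (inv_mem (hi b hb))
  have h1 : ∀ i j, M z i j := by
    intro i j g hg
    by_cases hi : o = i
    · subst hi; exact h j g hg
    by_cases hj : o = j
    · subst hj; exact hinv _ _ _ (h i) g hg
    exact hmul z o i j ho hi hj (h j) (h i) g hg
  have h2 : ∀ i j k, M i j k := by
    intro i j k
    by_cases hi : i = z
    · subst hi; exact h1 _ _
    by_cases hj : z = j
    · subst hj; exact hrot _ _ _ (hrot _ _ _ (h1 _ _))
    by_cases hk : z = k
    · subst hk; exact hrot _ _ _ (h1 _ _)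
    exact hmul i z j k hi hj hk (hrot _ _ _ (hrot _ _ _ (h1 _ _))) (hrot _ _ _ (hrot _ _ _ (h1 _ _)))
  intro g hg
  obtain ⟨a, ha⟩ : ∃ a, (g : Perm (Fin n)) a ≠ a := by
    by_contra! hc
    exact hg.ne_one (Equiv.ext hc)
  exact h2 _ _ _ g (exists_cyc hg a ha)

theorem aut_conj {n : ℕ} (hn : 5 ≤ n) (hn6 : n ≠ 6) (φ : alternatingGroup (Fin n) ≃* alternatingGroup (Fin n)) :
    ∃ s : Perm (Fin n), ∀ g : alternatingGroup (Fin n), (φ g : Perm (Fin n)) = s * g * s⁻¹ := by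
  obtain ⟨z, hz⟩ : ∃ z : Fin n, z.1 = 0 := ⟨⟨0, by omega⟩, rfl⟩
  obtain ⟨o, ho⟩ : ∃ z : Fin n, z.1 = 1 := ⟨⟨1, by omega⟩, rfl⟩
  obtain ⟨u, hu⟩ : ∃ z : Fin n, z.1 = 2 := ⟨⟨2, by omega⟩, rfl⟩
  obtain ⟨v, hv⟩ : ∃ z : Fin n, z.1 = 3 := ⟨⟨3, by omega⟩, rfl⟩
  have hzo : z ≠ o := by grind
  have hzu : u ≠ z := by grind
  have hzv : v ≠ z := by grind
  have hou : u ≠ o := by grind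
  have hov : v ≠ o := by grind
  have huv : u ≠ v := by grind
  have : ∀ i, ∃ t : alternatingGroup (Fin n), i ≠ z → i ≠ o → Cyc (t : Perm (Fin n)) z o i := by
    intro i
    by_cases h1 : i = z
    · exact ⟨1, fun h => absurd h1 h⟩
    by_cases h2 : i = o
    · exact ⟨1, fun _ h => absurd h2 h⟩
    obtain ⟨t, ht⟩ := exists_alt hzo (Ne.symm h2) (Ne.symm h1)
    exact ⟨t, fun _ _ => ht⟩
  choose X hX using this
  have hY : ∀ i, i ≠ z → i ≠ o → IsThreeCycle (φ (X i) : Perm (Fin n)) := fun i h1 h2 =>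
    phi_three hn hn6 φ _ (hX i h1 h2).three
  have hcy : ∀ i, i ≠ z → i ≠ o → ∃ a b c, Cyc (φ (X i) : Perm (Fin n)) a b c := by
    intro i h1 h2
    obtain ⟨a, ha⟩ : ∃ a, (φ (X i) : Perm (Fin n)) a ≠ a := by
      by_contra! hc
      exact (hY i h1 h2).ne_one (Equiv.ext hc)
    exact ⟨_, _, _, exists_cyc (hY i h1 h2) a ha⟩
  have hinj : ∀ i j, i ≠ z → i ≠ o → j ≠ z → j ≠ o → (φ (X i) : Perm (Fin n)) = φ (X j) → i = j := by
    intro i j h1 h2 h3 h4 h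
    have := φ.injective (Subtype.ext h)
    have h5 := (hX i h1 h2).2.2.2.2.1
    have h6 := (hX j h3 h4).2.2.2.2.1
    rw [← h5, ← h6, this]
  have hsh : ∀ i j, i ≠ z → i ≠ o → j ≠ z → j ≠ o → i ≠ j →
      ∃ x, (φ (X i) : Perm (Fin n)) x ≠ x ∧ (φ (X i) : Perm (Fin n)) x = (φ (X j) : Perm (Fin n)) x := by
    intro i j h1 h2 h3 h4 hij
    obtain ⟨a, b, c, hc⟩ := hcy i h1 h2
    obtain ⟨a', b', c', hc'⟩ := hcy j h3 h4
    obtain ⟨p1, p2⟩ := prod2 (hX i h1 h2) (hX j h3 h4) hij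
    have q1 : X i * X j * (X i * X j) = 1 := Subtype.ext p1
    have q2 : X i * X j ≠ 1 := fun h => p2 (congrArg Subtype.val h)
    have r1 := congrArg φ q1
    simp only [map_mul, map_one] at r1
    refine share hc hc' ?_ ?_
    · intro x
      have := congrArg (fun k : alternatingGroup (Fin n) => (k : Perm (Fin n)) x) r1
      simpa using this
    · by_contra! hcon
      apply q2
      apply φ.injective
      rw [map_mul, map_one]
      exact Subtype.ext (Equiv.ext hcon)
  obtain ⟨a, ha, hav⟩ := hsh u v hzu hou hzv hov huv
  set b := (φ (X u) : Perm (Fin n)) a with hb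
  have cu := exists_cyc (hY u hzu hou) a ha
  have cv := exists_cyc (hY v hzv hov) a (by rw [← hav]; exact ha)
  rw [← hav] at cv
  rw [← hb] at cu
  have hcd : (φ (X u) : Perm (Fin n)) b ≠ (φ (X v) : Perm (Fin n)) b := by
    intro h
    rw [h] at cu
    exact huv (hinj _ _ hzu hou hzv hov (cu.unique cv))
  have hab : ∀ i, i ≠ z → i ≠ o → (φ (X i) : Perm (Fin n)) a = b := by
    intro i h1 h2
    by_cases hiu : u = i
    · rw [← hiu]
    by_cases hiv : v = i
    · rw [← hiv, ← hav]
    obtain ⟨p, q, r, hc⟩ := hcy i h1 h2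
    exact share3 cu cv hc hcd (hsh u i hzu hou h1 h2 hiu) (hsh v i hzv hov h1 h2 hiv)
  have hci : ∀ i, i ≠ z → i ≠ o → Cyc (φ (X i) : Perm (Fin n)) a b ((φ (X i) : Perm (Fin n)) b) := by
    intro i h1 h2
    have h3 := hab i h1 h2
    have := exists_cyc (hY i h1 h2) a (by rw [h3]; exact ha)
    rwa [h3] at this
  let f : Fin n → Fin n := fun i => if i = z then a else if i = o then b else (φ (X i) : Perm (Fin n)) b
  have fz : f z = a := by simp [f]
  have fo : f o = b := by simp [f, hzo.symm]
  have fi : ∀ i, i ≠ z → i ≠ o → f i = (φ (X i) : Perm (Fin n)) b := by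
    intro i h1 h2; simp [f, h1, h2]
  have finj : Function.Injective f := by
    have key : ∀ i, i ≠ z → i ≠ o → f i ≠ a ∧ f i ≠ b := by
      intro i h1 h2
      have := hci i h1 h2
      rw [fi i h1 h2]
      exact ⟨this.2.2.1.symm, this.2.1.symm⟩
    have key2 : ∀ i j, i ≠ z → i ≠ o → j ≠ z → j ≠ o → f i = f j → i = j := by
      intro i j h1 h2 h3 h4 h
      rw [fi i h1 h2, fi j h3 h4] at h
      have c1 := hci i h1 h2
      have c2 := hci j h3 h4
      rw [h] at c1
      exact hinj i j h1 h2 h3 h4 (c1.unique c2)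
    have hab' : a ≠ b := cu.1
    intro i j hij
    by_cases i1 : i = z <;> by_cases i2 : i = o <;> by_cases j1 : j = z <;> by_cases j2 : j = o <;> grind
  let s : Perm (Fin n) := Equiv.ofBijective f (Finite.injective_iff_bijective.1 finj)
  have hs : ∀ i, s i = f i := fun i => rfl
  refine ⟨s, ?_⟩
  let f1 : alternatingGroup (Fin n) →* Perm (Fin n) := (alternatingGroup (Fin n)).subtype.comp φ.toMonoidHom
  let f2 : alternatingGroup (Fin n) →* Perm (Fin n) := (MulAut.conj s).toMonoidHom.comp (alternatingGroup (Fin n)).subtype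
  have htop : f1.eqLocus f2 = ⊤ := by
    apply gen z o hzo
    intro i g hg
    have h1 : i ≠ z := hg.2.2.1.symm
    have h2 : i ≠ o := hg.2.1.symm
    obtain rfl : g = X i := Subtype.ext (hg.unique (hX i h1 h2))
    change (φ (X i) : Perm (Fin n)) = s * (X i) * s⁻¹
    have c1 := hci i h1 h2
    have c2 := hg.conj s
    rw [hs, hs, hs, fz, fo, fi i h1 h2] at c2
    exact c1.unique c2
  intro g
  have : g ∈ f1.eqLocus f2 := by rw [htop]; trivial
  exact this

theorem center_triv {n : ℕ} (hn : 5 ≤ n) (w : alternatingGroup (Fin n)) (hw : ∀ g, w * g = g * w) : w = 1 := by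
  apply Subtype.ext
  apply Equiv.ext
  intro x
  by_contra hx
  change (w : Perm (Fin n)) x ≠ x at hx
  have key : ∀ y, y ≠ x → y ≠ (w : Perm (Fin n)) x → (w : Perm (Fin n)) y = x := by
    intro y h1 h2
    obtain ⟨g, hg⟩ := exists_alt h1.symm h2 hx.symm
    have := congrArg (fun k : alternatingGroup (Fin n) => (k : Perm (Fin n)) x) (hw g)
    simp only [Subgroup.coe_mul, mul_apply] at this
    rwa [hg.2.2.2.1, hg.2.2.2.2.2.1] at this
  have hcard : 1 < (Finset.univ \ {x, (w : Perm (Fin n)) x} : Finset (Fin n)).card := by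
    have := Finset.le_card_sdiff ({x, (w : Perm (Fin n)) x} : Finset (Fin n)) Finset.univ
    have h2 : ({x, (w : Perm (Fin n)) x} : Finset (Fin n)).card ≤ 2 := Finset.card_le_two
    simp at this
    omega
  obtain ⟨y, hy, y', hy', hne⟩ := Finset.one_lt_card.1 hcard
  simp at hy hy'
  apply hne
  apply (w : Perm (Fin n)).injective
  rw [key y hy.1 hy.2, key y' hy'.1 hy'.2]

theorem stmt_16 (n : ℕ) (hn : 5 ≤ n) (hn6 : n ≠ 6) (N : Type*) [Group N]
    (A : Subgroup N) (hA : A.Normal) (hidx : A.index = 2)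
    (hAiso : Nonempty (A ≃* alternatingGroup (Fin n))) :
    ∃ η : N, orderOf η = 2 ∧ η ∉ A := by
  obtain ⟨e⟩ := hAiso
  obtain ⟨t, ht⟩ : ∃ t, t ∉ A := by
    by_contra! h
    have : A = ⊤ := by rw [eq_top_iff]; exact fun x _ => h x
    rw [this] at hidx
    simp at hidx
  obtain ⟨s, hs⟩ := aut_conj hn hn6 (e.symm.trans ((MulAut.conjNormal t : MulAut A).trans e))
  obtain ⟨τ, hτ, hsg⟩ : ∃ τ : Perm (Fin n), τ * τ = 1 ∧ sign τ = sign s := by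
    rcases Int.units_eq_one_or (sign s) with h | h
    · exact ⟨1, by simp, by simp [h]⟩
    · refine ⟨swap ⟨0, by omega⟩ ⟨1, by omega⟩, swap_mul_self _ _, ?_⟩
      rw [h, sign_swap]
      simp
  let a : A := e.symm ⟨τ * s⁻¹, by rw [mem_alternatingGroup]; simp [hsg]⟩
  have hconj : ∀ x : A, (e (MulAut.conjNormal ((a : N) * t) x) : Perm (Fin n)) = τ * e x * τ⁻¹ := by
    intro x
    have h1 := hs (e x)
    simp only [MulEquiv.trans_apply, MulEquiv.symm_apply_apply] at h1
    have h2 : (MulAut.conjNormal ((a : N) * t) x : A) = a * MulAut.conjNormal t x * a⁻¹ := by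
      apply Subtype.ext
      simp [mul_assoc]
    have h3 : (e a : Perm (Fin n)) = τ * s⁻¹ := by simp [a]
    rw [h2]
    simp only [map_mul, map_inv, Subgroup.coe_mul, Subgroup.coe_inv, h1, h3]
    group
  have hm : (a : N) * t * ((a : N) * t) ∈ A := A.mul_self_mem_of_index_two hidx _
  have hτi : τ⁻¹ = τ := inv_eq_of_mul_eq_one_left hτ
  have h1 : e ⟨_, hm⟩ = 1 := by
    apply center_triv hn
    intro g
    obtain ⟨x, rfl⟩ := e.surjective g
    have h2 : MulAut.conjNormal ((a : N) * t) (MulAut.conjNormal ((a : N) * t) x) = (⟨_, hm⟩ : A) * x * (⟨_, hm⟩ : A)⁻¹ := by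
      apply Subtype.ext
      simp [mul_assoc]
    have h3 : e (MulAut.conjNormal ((a : N) * t) (MulAut.conjNormal ((a : N) * t) x)) = e x := by
      apply Subtype.ext
      rw [hconj, hconj, hτi]
      calc τ * (τ * (e x : Perm (Fin n)) * τ) * τ = (τ * τ) * e x * (τ * τ) := by group
        _ = _ := by rw [hτ]; simp
    rw [h2, map_mul, map_mul, map_inv, mul_inv_eq_iff_eq_mul] at h3
    exact h3
  have h2 : (a : N) * t * ((a : N) * t) = 1 := by
    have := (map_eq_one_iff e e.injective).1 h1
    exact congrArg Subtype.val this
  have h3 : (a : N) * t ∉ A := fun h => ht ((A.mul_mem_cancel_left a.2).1 h)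
  refine ⟨(a : N) * t, orderOf_eq_prime (by rw [pow_two, h2]) ?_, h3⟩
  intro h
  exact h3 (h ▸ A.one_mem)
end

section
/- For n ≥ 5, the alternating group Aₙ has no fixed-point-free automorphism: for every automorphism φ of Aₙ there exists a nontrivial element σ ∈ Aₙ with φ(σ) = σ. -/
theorem aux_ineq3 (k : ℕ) : 2 * (3 ^ (k+2) * (k+3).factorial) < (3*k+6).factorial := by
  induction k with
  | zero => decide
  | succ k ih =>
    have e1 : (3*(k+1)+6).factorial = (3*k+9)*((3*k+8)*((3*k+7)*(3*k+6).factorial)) := by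
      rw [show 3*(k+1)+6 = 3*k+6+1+1+1 by ring, Nat.factorial_succ, Nat.factorial_succ,
        Nat.factorial_succ]
    have e2 : (k+1+3).factorial = (k+4)*(k+3).factorial := by
      rw [show k+1+3 = k+3+1 by ring, Nat.factorial_succ]
    rw [e1, e2]
    have h : 3*(k+4) ≤ (3*k+9)*((3*k+8)*(3*k+7)) := by
      ring_nf; nlinarith [Nat.zero_le (k^2), Nat.zero_le (k^3)]
    calc 2 * (3 ^ (k+1+2) * ((k+4)*(k+3).factorial))
        = (3*(k+4)) * (2 * (3 ^ (k+2) * (k+3).factorial)) := by ring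
      _ < (3*(k+4)) * (3*k+6).factorial := by
          apply Nat.mul_lt_mul_of_pos_left ih; omega
      _ ≤ ((3*k+9)*((3*k+8)*(3*k+7))) * (3*k+6).factorial := Nat.mul_le_mul_right _ h
      _ = _ := by ring

theorem aux_ineq (n k : ℕ) (hn : 7 ≤ n) (hk : 3 * (k+2) ≤ n) :
    2 * ((n - 3*(k+2)).factorial * (3 ^ (k+2)) * (k+2).factorial) < (n-3).factorial * 3 := by
  cases k with
  | zero =>
    obtain ⟨m, rfl⟩ := Nat.exists_eq_add_of_le hn
    rw [show 7 + m - 3 * (0+2) = m+1 by omega, show 7+m-3 = m+1+1+1+1 by omega,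
      Nat.factorial_succ (m+1+1+1), Nat.factorial_succ (m+1+1), Nat.factorial_succ (m+1)]
    have := Nat.factorial_pos (m+1)
    have h2 : (0+2).factorial = 2 := rfl
    rw [h2]
    have h : 36 < (m+1+1+1+1) * ((m+1+1+1) * (m+1+1)) * 3 := by
      ring_nf; nlinarith [Nat.zero_le (m^2), Nat.zero_le (m^3)]
    calc _ = 36 * (m+1).factorial := by ring
      _ < ((m+1+1+1+1) * ((m+1+1+1) * (m+1+1)) * 3) * (m+1).factorial :=
        Nat.mul_lt_mul_of_pos_right h this
      _ = _ := by ring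
  | succ k =>
    obtain ⟨m, rfl⟩ := Nat.exists_eq_add_of_le hk
    rw [show 3 * (k+1+2) + m - 3 * (k+1+2) = m by omega,
      show 3 * (k+1+2) + m - 3 = m + (3*k+6) by omega]
    have h1 := Nat.le_of_dvd (Nat.factorial_pos _)
      (Nat.factorial_mul_factorial_dvd_factorial_add m (3*k+6))
    have h2 := aux_ineq3 k
    have := Nat.factorial_pos m
    calc _ = 3 * m.factorial * (2 * (3 ^ (k+2) * (k+3).factorial)) := by ring_nf
      _ < 3 * m.factorial * (3*k+6).factorial := Nat.mul_lt_mul_of_pos_left h2 (by positivity)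
      _ = (m.factorial * (3*k+6).factorial) * 3 := by ring
      _ ≤ _ := Nat.mul_le_mul_right _ h1

open Equiv Equiv.Perm

theorem aux_conj {G : Type*} [Group G] [Finite G] (φ : MulAut G) (c : G) (hc : c ≠ 1)
    (h : IsConj c (φ c)) : ∃ σ : G, σ ≠ 1 ∧ φ σ = σ := by
  by_contra hcon
  have hf : MonoidHom.FixedPointFree φ := fun g hg => by
    by_contra h1
    exact hcon ⟨g, h1, hg⟩
  obtain ⟨g, hg⟩ := isConj_iff.1 h
  obtain ⟨x, hx⟩ := hf.commutatorMap_surjective g⁻¹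
  rw [MonoidHom.commutatorMap_apply] at hx
  have hx' : φ x = g * x := by
    rw [div_eq_iff_eq_mul] at hx
    rw [eq_comm, ← eq_inv_mul_iff_mul_eq]; exact hx
  refine hcon ⟨x⁻¹ * c * x, ?_, ?_⟩
  · intro h1
    apply hc
    have : c = x * (x⁻¹ * c * x) * x⁻¹ := by group
    rw [this, h1]; group
  · rw [map_mul, map_mul, map_inv, hx', ← hg]; group

theorem aux_card_le {n : ℕ} (c : alternatingGroup (Fin n)) :
    Nat.card {h : alternatingGroup (Fin n) // h * c = c * h} ≤
      Nat.card (Subgroup.centralizer {(c : Perm (Fin n))}) := by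
  apply Nat.card_le_card_of_injective
    (fun h => ⟨(h.1 : Perm (Fin n)), by
      rw [Subgroup.mem_centralizer_singleton_iff]
      exact congrArg Subtype.val h.2⟩)
  intro a b hab
  have h1 := congrArg Subtype.val hab
  exact Subtype.ext (Subtype.ext h1)

theorem aux_card_ge {n : ℕ} (hn : 5 ≤ n) (c : alternatingGroup (Fin n)) :
      Nat.card (Subgroup.centralizer {(c : Perm (Fin n))}) ≤
    2 * Nat.card {h : alternatingGroup (Fin n) // h * c = c * h} := by
  have : Nontrivial (Fin n) := Fin.nontrivial_iff_two_le.2 (by omega)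
  set C := Subgroup.centralizer {(c : Perm (Fin n))} with hC
  rw [← Subgroup.index_mul_card ((alternatingGroup (Fin n)).subgroupOf C)]
  apply Nat.mul_le_mul
  · have h := Subgroup.relIndex_dvd_index_of_normal (alternatingGroup (Fin n)) C
    rw [alternatingGroup.index_eq_two] at h
    exact Nat.le_of_dvd (by norm_num) h
  · apply Nat.card_le_card_of_injective
      (fun h => (⟨⟨h.1.1, h.2⟩, by
        exact Subtype.ext (Subgroup.mem_centralizer_singleton_iff.1 h.1.2)⟩ : {h : alternatingGroup (Fin n) // h * c = c * h}))
    intro a b hab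
    have h1 := congrArg (fun z => (z.1.1 : Perm (Fin n))) hab
    exact Subtype.ext (Subtype.ext h1)

theorem aux_card_eq {G : Type*} [Group G] (φ : MulAut G) (c : G) :
    Nat.card {h : G // h * c = c * h} = Nat.card {h : G // h * φ c = φ c * h} := by
  apply Nat.card_congr
  refine φ.toEquiv.subtypeEquiv fun a => ?_
  change _ ↔ φ a * φ c = φ c * φ a
  rw [← map_mul, ← map_mul, φ.injective.eq_iff]

theorem aux_centr {n k : ℕ} (g : Perm (Fin n)) (h : g.cycleType = Multiset.replicate (k+1) 3) :
    Nat.card (Subgroup.centralizer {g}) =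
      (n - 3*(k+1)).factorial * 3 ^ (k+1) * (k+1).factorial := by
  rw [nat_card_centralizer, h, Multiset.toFinset_replicate, if_neg (Nat.succ_ne_zero k),
    Finset.prod_singleton, Multiset.count_replicate_self, Multiset.prod_replicate,
    Multiset.sum_replicate, Fintype.card_fin, smul_eq_mul, mul_comm 3]

theorem aux_six (φ : MulAut (alternatingGroup (Fin 6))) :
    ∃ σ : alternatingGroup (Fin 6), σ ≠ 1 ∧ φ σ = σ := by
  have key : ∀ s : alternatingGroup (Fin 6), orderOf s = 2 →
      (s : Perm (Fin 6)).cycleType = Multiset.replicate 2 2 := by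
    intro s hs
    have ho : orderOf (s : Perm (Fin 6)) = 2 := by rw [Subgroup.orderOf_coe, hs]
    obtain ⟨k, hk⟩ := cycleType_prime_order (σ := (s : Perm (Fin 6))) (by rw [ho]; norm_num)
    rw [ho] at hk
    have h1 := (s : Perm (Fin 6)).sum_cycleType
    have h2 := Finset.card_le_univ (s : Perm (Fin 6)).support
    rw [← h1, hk] at h2
    have h3 : sign (s : Perm (Fin 6)) = 1 := s.2
    rw [sign_of_cycleType, hk] at h3
    simp at h2 h3
    have : k ≤ 2 := by omega
    interval_cases k
    · exact absurd h3 (by decide)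
    · exact hk
    · exact absurd h3 (by decide)
  let c : alternatingGroup (Fin 6) := ⟨swap 0 1 * swap 2 3, by
    rw [mem_alternatingGroup]; decide⟩
  have hc : orderOf c = 2 := by
    apply orderOf_eq_prime
    · decide
    · decide
  have hc' : orderOf (φ c) = 2 := by rw [MulEquiv.orderOf_eq, hc]
  apply aux_conj φ c
  · decide
  · apply alternatingGroup.isConj_of
    · rw [isConj_iff_cycleType_eq, key _ hc, key _ hc']
    · rw [← sum_cycleType, key _ hc]; simp

theorem stmt_18 (n : ℕ) (hn : 5 ≤ n) (φ : MulAut (alternatingGroup (Fin n))) :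
    ∃ σ : alternatingGroup (Fin n), σ ≠ 1 ∧ φ σ = σ := by
  by_cases h6 : n = 6
  · subst h6; exact aux_six φ
  have h3 : ({⟨0, by omega⟩, ⟨1, by omega⟩, ⟨2, by omega⟩} : Finset (Fin n)).card = 3 := by
    rw [Finset.card_eq_three]
    exact ⟨_, _, _, by simp, by simp, by simp, rfl⟩
  have hthree : IsThreeCycle (swap (⟨0, by omega⟩ : Fin n) ⟨1, by omega⟩ *
      swap ⟨0, by omega⟩ ⟨2, by omega⟩) :=
    isThreeCycle_swap_mul_swap_same (by simp) (by simp) (by simp)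
  obtain ⟨c, hc⟩ : ∃ c : alternatingGroup (Fin n), IsThreeCycle (c : Perm (Fin n)) :=
    ⟨⟨_, hthree.mem_alternatingGroup⟩, hthree⟩
  have ho : orderOf c = 3 := by rw [← Subgroup.orderOf_coe, hc.orderOf]
  have ho' : orderOf (φ c : Perm (Fin n)) = 3 := by
    rw [Subgroup.orderOf_coe, MulEquiv.orderOf_eq, ho]
  apply aux_conj φ c
  · rintro rfl
    simp at ho
  apply alternatingGroup.isThreeCycle_isConj (by simpa using hn) hc
  obtain ⟨k, hk⟩ := cycleType_prime_order (σ := (φ c : Perm (Fin n))) (by rw [ho']; norm_num)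
  rw [ho'] at hk
  have hsum : 3 * (k+1) ≤ n := by
    have h2 := Finset.card_le_univ (φ c : Perm (Fin n)).support
    rw [← sum_cycleType, hk] at h2
    simp at h2
    omega
  cases k with
  | zero => exact hk
  | succ k =>
    exfalso
    have e1 := aux_card_ge hn c
    have e2 := aux_card_le (φ c)
    rw [aux_card_eq φ c] at e1
    rw [aux_centr _ hk] at e2
    rw [aux_centr (k := 0) _ hc] at e1
    have := aux_ineq n k (by omega) hsum
    simp only [zero_add, mul_one, pow_one, Nat.factorial_one] at e1
    have e3 : k + 1 + 1 = k + 2 := rfl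
    rw [e3] at e2
    omega
end
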